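/- There is no nonzero operator T ∈ L(c₀;c₀) with the Bhatia–Šemrl property; that is, BS(c₀;c₀) = {0}. -/

import Mathlib

noncomputable section

/-- `x` is Birkhoff--James orthogonal to `y`: `‖x‖ ≤ ‖x + a • y‖` for every scalar `a`. -/
def BJOrth (𝕂 : Type*) [RCLike 𝕂] {E : Type*} [NormedAddCommGroup E] [NormedSpace 𝕂 E]
    (x y : E) : Prop :=
  ∀ a : 𝕂, ‖x‖ ≤ ‖x + a • y‖

/-- The Bhatia--Šemrl property for bounded linear operators: whenever `T ⊥_B S` there is a
norm attaining point `x` of `T` with `T x ⊥_B S x`. -/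
def HasBSProp (𝕂 : Type*) [RCLike 𝕂] {X Y : Type*} [NormedAddCommGroup X] [NormedSpace 𝕂 X]
    [NormedAddCommGroup Y] [NormedSpace 𝕂 Y] (T : X →L[𝕂] Y) : Prop :=
  ∀ S : X →L[𝕂] Y, BJOrth 𝕂 T S →
    ∃ x : X, ‖x‖ = 1 ∧ ‖T x‖ = ‖T‖ ∧ BJOrth 𝕂 (T x) (S x)

open scoped ZeroAtInfty Topology
open Filter

section SequenceSpace

variable {𝕂 : Type*} [RCLike 𝕂]

/-- The element of `c₀` given by a sequence tending to zero. -/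
def c0OfTendsto (f : ℕ → 𝕂) (hf : Tendsto f atTop (𝓝 0)) : C₀(ℕ, 𝕂) where
  toFun := f
  continuous_toFun := continuous_of_discreteTopology
  zero_at_infty' := by rwa [cocompact_eq_cofinite, Nat.cofinite_eq_atTop]

@[simp]
lemma c0OfTendsto_apply (f : ℕ → 𝕂) (hf : Tendsto f atTop (𝓝 0)) (n : ℕ) :
    c0OfTendsto f hf n = f n := rfl

lemma c0_tendsto (x : C₀(ℕ, 𝕂)) : Tendsto x atTop (𝓝 0) := by
  have h := x.zero_at_infty'
  rwa [cocompact_eq_cofinite, Nat.cofinite_eq_atTop] at h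

lemma c0_norm_apply_le (x : C₀(ℕ, 𝕂)) (n : ℕ) : ‖x n‖ ≤ ‖x‖ := by
  rw [← ZeroAtInftyContinuousMap.norm_toBCF_eq_norm]
  exact x.toBCF.norm_coe_le_norm n

lemma c0_norm_le {x : C₀(ℕ, 𝕂)} {C : ℝ} (hC : 0 ≤ C) (h : ∀ n, ‖x n‖ ≤ C) : ‖x‖ ≤ C := by
  rw [← ZeroAtInftyContinuousMap.norm_toBCF_eq_norm]
  exact (BoundedContinuousFunction.norm_le hC).2 h

lemma c0_exists_norm_lt (x : C₀(ℕ, 𝕂)) {ε : ℝ} (hε : 0 < ε) :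
    ∃ m, ∀ n, m ≤ n → ‖x n‖ < ε := by
  have h := (c0_tendsto x).norm
  rw [norm_zero] at h
  exact eventually_atTop.1 (h.eventually (gt_mem_nhds hε))

/-- The norm of a sequence in `c₀` is attained at some coordinate. -/
lemma c0_exists_norm_apply_eq (x : C₀(ℕ, 𝕂)) : ∃ n, ‖x n‖ = ‖x‖ := by
  by_cases hx : x = 0
  · exact ⟨0, by simp [hx]⟩
  obtain ⟨k, hk⟩ : ∃ k, x k ≠ 0 := by
    by_contra! h
    exact hx (by ext n; simpa using h n)
  obtain ⟨m, hm⟩ := c0_exists_norm_lt x (norm_pos_iff.2 hk)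
  have hcont : Continuous fun n => ‖x n‖ := continuous_of_discreteTopology
  obtain ⟨n, hn⟩ := hcont.exists_forall_ge' k (by
    rw [cocompact_eq_cofinite, Nat.cofinite_eq_atTop]
    exact eventually_atTop.2 ⟨m, fun n h => (hm n h).le⟩)
  exact ⟨n, le_antisymm (c0_norm_apply_le x n) (c0_norm_le (norm_nonneg _) hn)⟩

/-- The sequence equal to `c` on `[m, m + K)` and to `x` before `m`, vanishing afterwards. -/
def c0Splice (x : C₀(ℕ, 𝕂)) (m K : ℕ) (c : 𝕂) : C₀(ℕ, 𝕂) :=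
  c0OfTendsto (fun n => if n < m then x n else if n < m + K then c else 0)
    (tendsto_const_nhds.congr' (eventually_atTop.2 ⟨m + K, fun n hn => by
      simp [show ¬ n < m by lia, show ¬ n < m + K by lia]⟩))

lemma c0Splice_apply (x : C₀(ℕ, 𝕂)) (m K : ℕ) (c : 𝕂) (n : ℕ) :
    c0Splice x m K c n = if n < m then x n else if n < m + K then c else 0 := rfl

lemma norm_c0Splice_le {x : C₀(ℕ, 𝕂)} (hx : ‖x‖ ≤ 1) (m K : ℕ) {c : 𝕂} (hc : ‖c‖ ≤ 1) :
    ‖c0Splice x m K c‖ ≤ 1 := by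
  refine c0_norm_le zero_le_one fun n => ?_
  rw [c0Splice_apply]
  split_ifs
  · exact (c0_norm_apply_le x n).trans hx
  · exact hc
  · simp

/-- The unit vectors of `c₀`. -/
def c0Single (k : ℕ) : C₀(ℕ, 𝕂) :=
  c0OfTendsto (fun n => if n = k then 1 else 0)
    (tendsto_const_nhds.congr' (eventually_atTop.2 ⟨k + 1, fun n hn => by
      simp [show n ≠ k by lia]⟩))

lemma c0Single_apply_self (k : ℕ) : c0Single (𝕂 := 𝕂) k k = 1 := by simp [c0Single]

lemma norm_c0Single_le (k : ℕ) : ‖c0Single (𝕂 := 𝕂) k‖ ≤ 1 :=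
  c0_norm_le zero_le_one fun n => by
    by_cases h : n = k <;> simp [c0Single, h]

lemma tsum_half_pow_succ : ∑' k : ℕ, (1 / 2 : ℝ) ^ (k + 1) = 1 := by
  simp_rw [pow_succ, tsum_mul_right, tsum_geometric_two]
  norm_num

lemma summable_half_pow_succ : Summable fun k : ℕ => (1 / 2 : ℝ) ^ (k + 1) :=
  (summable_nat_add_iff 1).2 summable_geometric_two

lemma norm_half_pow_mul_le (x : C₀(ℕ, 𝕂)) (m k : ℕ) :
    ‖((1 / 2 : ℝ) ^ (k + 1) : ℝ) • x (m + k)‖ ≤ (1 / 2 : ℝ) ^ (k + 1) * ‖x‖ := by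
  rw [norm_smul, Real.norm_of_nonneg (by positivity)]
  exact mul_le_mul_of_nonneg_left (c0_norm_apply_le x _) (by positivity)

lemma summable_half_pow_smul (x : C₀(ℕ, 𝕂)) (m : ℕ) :
    Summable fun k : ℕ => ((1 / 2 : ℝ) ^ (k + 1)) • x (m + k) :=
  (summable_half_pow_succ.mul_right ‖x‖).of_norm_bounded (norm_half_pow_mul_le x m)

/-- The functional `x ↦ ∑ k, (1 / 2) ^ (k + 1) • x (m + k)` on `c₀`. -/
def c0GeomTail (m : ℕ) : C₀(ℕ, 𝕂) →L[𝕂] 𝕂 :=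
  LinearMap.mkContinuous
    { toFun := fun x => ∑' k : ℕ, ((1 / 2 : ℝ) ^ (k + 1)) • x (m + k)
      map_add' := fun x y => by
        rw [← (summable_half_pow_smul x m).tsum_add (summable_half_pow_smul y m)]
        simp
      map_smul' := fun c x => by
        rw [RingHom.id_apply, ← (summable_half_pow_smul x m).tsum_const_smul c]
        refine tsum_congr fun k => ?_
        rw [ZeroAtInftyContinuousMap.smul_apply, smul_comm] }
    1 fun x => tsum_of_norm_bounded
      (by
        have h := summable_half_pow_succ.hasSum.mul_right ‖x‖
        rwa [tsum_half_pow_succ] at h)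
      (norm_half_pow_mul_le x m)

lemma c0GeomTail_apply (m : ℕ) (x : C₀(ℕ, 𝕂)) :
    c0GeomTail m x = ∑' k : ℕ, ((1 / 2 : ℝ) ^ (k + 1)) • x (m + k) := rfl

/-- The functional `c0GeomTail m`, which has norm one, does not attain its norm. -/
lemma norm_c0GeomTail_lt_one (m : ℕ) {x : C₀(ℕ, 𝕂)} (hx : ‖x‖ = 1) :
    ‖c0GeomTail m x‖ < 1 := by
  have hle (k : ℕ) : ‖((1 / 2 : ℝ) ^ (k + 1)) • x (m + k)‖ ≤ (1 / 2 : ℝ) ^ (k + 1) := by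
    simpa [hx] using norm_half_pow_mul_le x m k
  have hs : Summable fun k : ℕ => ‖((1 / 2 : ℝ) ^ (k + 1)) • x (m + k)‖ :=
    summable_half_pow_succ.of_nonneg_of_le (fun _ => norm_nonneg _) hle
  obtain ⟨j, hj⟩ := c0_exists_norm_lt x one_pos
  rw [c0GeomTail_apply]
  refine (norm_tsum_le_tsum_norm hs).trans_lt ?_
  refine lt_of_lt_of_eq (hs.tsum_lt_tsum (i := j) hle ?_ summable_half_pow_succ)
    tsum_half_pow_succ
  rw [norm_smul, Real.norm_of_nonneg (by positivity)]
  exact mul_lt_of_lt_one_right (by positivity) (hj _ (by lia))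

lemma c0GeomTail_c0Splice (x : C₀(ℕ, 𝕂)) (m K : ℕ) (c : 𝕂) :
    c0GeomTail m (c0Splice x m K c) = (1 - (1 / 2 : ℝ) ^ K) • c := by
  rw [c0GeomTail_apply, tsum_eq_sum (s := Finset.range K)]
  · have h : ∀ k ∈ Finset.range K, ((1 / 2 : ℝ) ^ (k + 1)) • c0Splice x m K c (m + k) =
        ((1 / 2 : ℝ) ^ (k + 1)) • c := fun k hk => by
      simp [c0Splice_apply, Finset.mem_range.1 hk]
    rw [Finset.sum_congr rfl h, ← Finset.sum_smul]
    congr 1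
    clear h
    induction K with
    | zero => simp
    | succ K ih => rw [Finset.sum_range_succ, ih]; ring
  · intro k hk
    rw [Finset.mem_range] at hk
    simp [c0Splice_apply, hk]

lemma eq_zero_of_norm_add_le_of_norm_sub_le {a b : 𝕂}
    (h₁ : ‖a + b‖ ≤ ‖a‖) (h₂ : ‖a - b‖ ≤ ‖a‖) : b = 0 := by
  have h := parallelogram_law_with_norm 𝕂 a b
  have h₃ : ‖b‖ * ‖b‖ ≤ 0 := by
    nlinarith [mul_self_le_mul_self (norm_nonneg _) h₁, mul_self_le_mul_self (norm_nonneg _) h₂]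
  exact norm_eq_zero.1 (by nlinarith [norm_nonneg b])

/-- A functional on `c₀` attaining its norm at `x` vanishes on the sequences supported where `x`
is at most `1 / 2` in absolute value. -/
lemma eq_zero_of_norm_attained {t : C₀(ℕ, 𝕂) →ₗ[𝕂] 𝕂} {x : C₀(ℕ, 𝕂)} (hx : ‖x‖ ≤ 1)
    (ht : ∀ u, ‖u‖ ≤ 1 → ‖t u‖ ≤ ‖t x‖) {m : ℕ} (hm : ∀ n, m ≤ n → ‖x n‖ ≤ 1 / 2)
    {y : C₀(ℕ, 𝕂)} (hy : ‖y‖ ≤ 1 / 2) (hy_zero : ∀ n < m, y n = 0) : t y = 0 := by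
  apply eq_zero_of_norm_add_le_of_norm_sub_le (a := t x)
  · rw [← map_add]
    refine ht _ (c0_norm_le zero_le_one fun n => ?_)
    rw [ZeroAtInftyContinuousMap.add_apply]
    rcases lt_or_ge n m with h | h
    · rw [hy_zero n h, add_zero]
      exact (c0_norm_apply_le x n).trans hx
    · linarith [norm_add_le (x n) (y n), hm n h, c0_norm_apply_le y n]
  · rw [← map_sub]
    refine ht _ (c0_norm_le zero_le_one fun n => ?_)
    rw [ZeroAtInftyContinuousMap.sub_apply]
    rcases lt_or_ge n m with h | h
    · rw [hy_zero n h, sub_zero]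
      exact (c0_norm_apply_le x n).trans hx
    · linarith [norm_sub_le (x n) (y n), hm n h, c0_norm_apply_le y n]

/-- A functional on `c₀` attaining its norm at `x` takes the same value at sequences that agree
with `x` on the coordinates where `x` is not small. -/
lemma eq_of_norm_attained {t : C₀(ℕ, 𝕂) →ₗ[𝕂] 𝕂} {x : C₀(ℕ, 𝕂)} (hx : ‖x‖ ≤ 1)
    (ht : ∀ u, ‖u‖ ≤ 1 → ‖t u‖ ≤ ‖t x‖) {m : ℕ} (hm : ∀ n, m ≤ n → ‖x n‖ ≤ 1 / 2)
    {y : C₀(ℕ, 𝕂)} (hy : ‖y‖ ≤ 1) (hxy : ∀ n < m, y n = x n) : t y = t x := by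
  have h : t ((1 / 4 : 𝕂) • (y - x)) = 0 := by
    refine eq_zero_of_norm_attained hx ht hm ?_ fun n hn => by simp [hxy n hn]
    rw [norm_smul, norm_div, norm_one, RCLike.norm_ofNat]
    linarith [norm_sub_le y x]
  rw [map_smul, smul_eq_zero, map_sub, sub_eq_zero] at h
  exact h.resolve_left (by norm_num)

/-- Evaluation of sequences in `c₀` at a coordinate. -/
def c0Eval (n : ℕ) : C₀(ℕ, 𝕂) →ₗ[𝕂] 𝕂 where
  toFun x := x n
  map_add' _ _ := rfl
  map_smul' _ _ := rfl

lemma c0Eval_apply (n : ℕ) (x : C₀(ℕ, 𝕂)) : c0Eval n x = x n := rfl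

lemma eq_zero_of_hasBSProp {T : C₀(ℕ, 𝕂) →L[𝕂] C₀(ℕ, 𝕂)} (hT : HasBSProp 𝕂 T) : T = 0 := by
  by_contra hT_ne
  have hpos : 0 < ‖T‖ := (norm_nonneg T).lt_of_ne' fun h => hT_ne <|
    ContinuousLinearMap.ext fun u => norm_le_zero_iff.1 (by simpa [h] using T.le_opNorm u)
  obtain ⟨x, hx, hTx, -⟩ := hT 0 fun a => by simp
  obtain ⟨n, hn⟩ := c0_exists_norm_apply_eq (T x)
  obtain ⟨m, hm⟩ := c0_exists_norm_lt x one_half_pos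
  have hattain : ∀ u, ‖u‖ ≤ 1 →
      ‖(c0Eval n ∘ₗ (T : C₀(ℕ, 𝕂) →ₗ[𝕂] C₀(ℕ, 𝕂))) u‖ ≤
        ‖(c0Eval n ∘ₗ (T : C₀(ℕ, 𝕂) →ₗ[𝕂] C₀(ℕ, 𝕂))) x‖ := fun u hu => by
    change ‖T u n‖ ≤ ‖T x n‖
    rw [hn, hTx]
    exact (c0_norm_apply_le _ n).trans (T.unit_le_opNorm u hu)
  let R : C₀(ℕ, 𝕂) →L[𝕂] C₀(ℕ, 𝕂) :=
    (‖T‖ : 𝕂) • (c0GeomTail m).smulRight (c0Single n)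
  have hR_apply (u : C₀(ℕ, 𝕂)) : R u = (‖T‖ : 𝕂) • c0GeomTail m u • c0Single n := rfl
  have horth : BJOrth 𝕂 T (T + R) := by
    intro a
    have hK (K : ℕ) : ‖T‖ - ‖a‖ * ‖T‖ * (1 / 2 : ℝ) ^ K ≤ ‖T + a • (T + R)‖ := by
      set c : 𝕂 := -(T x n / (‖T‖ : 𝕂)) with hc
      have hc_norm : ‖c‖ ≤ 1 := by
        rw [hc, norm_neg, norm_div, hn, hTx, RCLike.norm_ofReal, abs_of_pos hpos,
          div_self hpos.ne']
      have hu : ‖c0Splice x m K c‖ ≤ 1 := norm_c0Splice_le hx.le m K hc_norm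
      have hTu : T (c0Splice x m K c) n = T x n :=
        eq_of_norm_attained hx.le hattain (fun k hk => (hm k hk).le) hu
          fun k hk => by simp [c0Splice_apply, hk]
      have hval : (T + a • (T + R)) (c0Splice x m K c) n =
          T x n + a * T x n * (((1 / 2 : ℝ) ^ K : ℝ) : 𝕂) := by
        have hne : (‖T‖ : 𝕂) ≠ 0 := by exact_mod_cast hpos.ne'
        have hRu : R (c0Splice x m K c) n =
            -(T x n) * (1 - (((1 / 2 : ℝ) ^ K : ℝ) : 𝕂)) := by
          rw [hR_apply, c0GeomTail_c0Splice, ZeroAtInftyContinuousMap.smul_apply,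
            ZeroAtInftyContinuousMap.smul_apply, c0Single_apply_self, RCLike.real_smul_eq_coe_mul,
            hc, smul_eq_mul, smul_eq_mul, mul_one, RCLike.ofReal_sub, RCLike.ofReal_one]
          field_simp
        change T (c0Splice x m K c) n +
          a * (T (c0Splice x m K c) n + R (c0Splice x m K c) n) = _
        rw [hTu, hRu]
        ring
      have hle := (c0_norm_apply_le _ n).trans ((T + a • (T + R)).unit_le_opNorm _ hu)
      rw [hval] at hle
      have hlow := norm_sub_le_norm_add (T x n) (a * T x n * (((1 / 2 : ℝ) ^ K : ℝ) : 𝕂))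
      rw [norm_mul, norm_mul, hn, hTx, RCLike.norm_ofReal, abs_of_nonneg (by positivity)] at hlow
      exact hlow.trans hle
    have hlim : Tendsto (fun K : ℕ => ‖T‖ - ‖a‖ * ‖T‖ * (1 / 2 : ℝ) ^ K) atTop (𝓝 ‖T‖) := by
      simpa using tendsto_const_nhds.sub
        ((tendsto_pow_atTop_nhds_zero_of_lt_one (r := (1 / 2 : ℝ)) (by norm_num)
          (by norm_num)).const_mul (‖a‖ * ‖T‖))
    exact le_of_tendsto' hlim hK
  obtain ⟨y, hy, hTy, hy_orth⟩ := hT _ horth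
  have h := hy_orth (-1)
  have hcalc : T y + (-1 : 𝕂) • (T + R) y = -R y := by
    rw [add_apply]
    module
  rw [hcalc, norm_neg, hTy, hR_apply, norm_smul, norm_smul, RCLike.norm_ofReal,
    abs_of_pos hpos] at h
  have hlt : ‖c0GeomTail m y‖ * ‖c0Single (𝕂 := 𝕂) n‖ < 1 :=
    (mul_le_of_le_one_right (norm_nonneg _) (norm_c0Single_le n)).trans_lt
      (norm_c0GeomTail_lt_one m hy)
  exact absurd h (not_le.2 (mul_lt_of_lt_one_right hpos hlt))

end SequenceSpace

open scoped ZeroAtInfty in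
/-- The zero operator is the only operator in `L(c₀;c₀)` with the Bhatia--Šemrl property. -/
theorem BS_c0_c0_eq_zero {𝕂 : Type*} [RCLike 𝕂] :
    {T : C₀(ℕ, 𝕂) →L[𝕂] C₀(ℕ, 𝕂) | HasBSProp 𝕂 T} = {0} := by
  ext T
  rw [Set.mem_ofPred_eq, Set.mem_singleton_iff]
  constructor
  · exact eq_zero_of_hasBSProp
  · rintro rfl S -
    refine ⟨c0Single 0, le_antisymm (norm_c0Single_le 0) ?_, by simp, fun a => by simp⟩
    simpa [c0Single_apply_self] using c0_norm_apply_le (c0Single (𝕂 := 𝕂) 0) 0
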